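/- Let χ1 and χ2 be the substitutions on {a,b} given by χ1(a)=aab, χ1(b)=ab and χ2(a)=baa, χ2(b)=ba, with fixed points u1 (beginning with a) and u2 (beginning with b). Then for every n ≥ 1 the number of occurrences of the letter a in the length-n prefix of u1 is exactly one more than the number of occurrences of a in the length-n prefix of u2. In particular the abelianizations of the length-n prefixes of u1 and u2 are never equal for n ≥ 1, so the canonical stepped lines of u1 and u2 in ℤ^2 have no common vertex other than the origin. -/

import Mathlib

/- STATEMENT 12: For the fixed points u1 of χ1 (beginning with a) and u2 of χ2
(beginning with b), every length-n prefix of u1 (n ≥ 1) contains exactly one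
more occurrence of the letter a than the length-n prefix of u2; consequently
the canonical stepped lines of u1 and u2 in ℤ² meet only at the origin. -/

namespace Stmt12

inductive AB : Type
  | a | b
deriving DecidableEq

/-- Extension of a substitution (letter → word) to finite words. -/
def subst (f : AB → List AB) (w : List AB) : List AB :=
  w.flatMap f

def χ1 : AB → List AB
  | .a => [.a, .a, .b]
  | .b => [.a, .b]

def χ2 : AB → List AB
  | .a => [.b, .a, .a]
  | .b => [.b, .a]

/-- `w` is a (finite) prefix of the infinite word `u`. -/
def IsPrefixOf (w : List AB) (u : ℕ → AB) : Prop :=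
  (List.range w.length).map u = w

/-- `u` is a fixed point of `σ` beginning with the letter `x`. -/
def IsFixedPointOf (σ : AB → List AB) (x : AB) (u : ℕ → AB) : Prop :=
  ∀ k : ℕ, IsPrefixOf ((subst σ)^[k] [x]) u

/-- Abelianization of a finite word over {a,b}, in ℤ². -/
def abel (w : List AB) : ℤ × ℤ :=
  ((w.count AB.a : ℤ), (w.count AB.b : ℤ))

/-- The length-`n` prefix of the infinite word `u`. -/
def prefixWord (u : ℕ → AB) (n : ℕ) : List AB :=
  (List.range n).map u

theorem subst_append (f : AB → List AB) (v w : List AB) :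
    subst f (v ++ w) = subst f v ++ subst f w := by
  simp [subst]

/-- `χ1` and `χ2` are conjugate by the letter `b`. -/
theorem cons_subst_χ1 (w : List AB) : .b :: subst χ1 w = subst χ2 w ++ [.b] := by
  induction w with
  | nil => rfl
  | cons x w ih =>
    cases x <;> simp_all [subst, χ1, χ2]

theorem length_le_length_subst_χ2 (w : List AB) : w.length ≤ (subst χ2 w).length := by
  induction w with
  | nil => simp
  | cons x w ih =>
    cases x <;> simp_all [subst, χ2] <;> omega

/-- After their first letters, the iterates of `χ1` on `a` and of `χ2` on `b` agree
on arbitrarily long words. -/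
theorem exists_common_tail (k : ℕ) :
    ∃ c e : List AB, (subst χ2)^[k] [.b] = .b :: c ∧
      (subst χ1)^[k] [.a] = .a :: (c ++ e) ∧ k ≤ c.length := by
  induction k with
  | zero => exact ⟨[], [], rfl, rfl, le_rfl⟩
  | succ k ih =>
    obtain ⟨c, e, h2, h1, hk⟩ := ih
    refine ⟨.a :: subst χ2 c, subst χ2 e ++ [.b], ?_, ?_, ?_⟩
    · rw [Function.iterate_succ_apply', h2]
      rfl
    · rw [Function.iterate_succ_apply', h1]
      change .a :: .a :: .b :: subst χ1 (c ++ e) = _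
      rw [cons_subst_χ1, subst_append]
      simp
    · have := length_le_length_subst_χ2 c
      simp only [List.length_cons]
      omega

theorem IsPrefixOf.getElem?_eq {w : List AB} {u : ℕ → AB} (h : IsPrefixOf w u) {i : ℕ}
    (hi : i < w.length) : w[i]? = some (u i) := by
  unfold IsPrefixOf at h
  rw [← h]
  simp [hi]

theorem prefixWord_succ (u : ℕ → AB) (n : ℕ) : prefixWord u (n + 1) = prefixWord u n ++ [u n] := by
  simp [prefixWord, List.range_succ]

theorem abel_fst_add_snd (w : List AB) : (abel w).1 + (abel w).2 = w.length := by
  induction w with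
  | nil => rfl
  | cons x w ih =>
    cases x <;> simp [abel] at ih ⊢ <;> omega

theorem fixedPoint_succ_eq {u1 u2 : ℕ → AB} (h1 : IsFixedPointOf χ1 .a u1)
    (h2 : IsFixedPointOf χ2 .b u2) (n : ℕ) : u1 (n + 1) = u2 (n + 1) := by
  obtain ⟨c, e, e2, e1, hc⟩ := exists_common_tail (n + 1)
  have p1 := h1 (n + 1)
  have p2 := h2 (n + 1)
  rw [e1] at p1
  rw [e2] at p2
  have q1 := p1.getElem?_eq (i := n + 1) (by simp; omega)
  have q2 := p2.getElem?_eq (i := n + 1) (by simp; omega)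
  rw [List.getElem?_cons_succ] at q1 q2
  rw [List.getElem?_append_left (by omega), q2] at q1
  exact (Option.some.inj q1).symm

theorem count_prefixWord_succ {u1 u2 : ℕ → AB} (h1 : IsFixedPointOf χ1 .a u1)
    (h2 : IsFixedPointOf χ2 .b u2) (n : ℕ) :
    (prefixWord u1 (n + 1)).count AB.a = (prefixWord u2 (n + 1)).count AB.a + 1 := by
  induction n with
  | zero =>
    have e1 : [u1 0] = [.a] := h1 0
    have e2 : [u2 0] = [.b] := h2 0
    simp only [prefixWord_succ, e1, e2]
    rfl
  | succ n ih =>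
    rw [prefixWord_succ u1, prefixWord_succ u2, List.count_append, List.count_append, ih,
      fixedPoint_succ_eq h1 h2]
    omega

theorem stepped_lines_meet_only_at_origin
    (u1 u2 : ℕ → AB)
    (h1 : IsFixedPointOf χ1 .a u1) (h2 : IsFixedPointOf χ2 .b u2) :
    (∀ n : ℕ, 1 ≤ n →
      (prefixWord u1 n).count AB.a = (prefixWord u2 n).count AB.a + 1) ∧
    (∀ n : ℕ, 1 ≤ n → abel (prefixWord u1 n) ≠ abel (prefixWord u2 n)) ∧
    (∀ m n : ℕ, abel (prefixWord u1 m) = abel (prefixWord u2 n) → m = 0 ∧ n = 0) := by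
  have count_eq : ∀ n : ℕ, 1 ≤ n →
      (prefixWord u1 n).count AB.a = (prefixWord u2 n).count AB.a + 1 := by
    intro n hn
    obtain ⟨m, rfl⟩ := Nat.exists_eq_add_of_le' hn
    exact count_prefixWord_succ h1 h2 m
  have abel_ne : ∀ n : ℕ, 1 ≤ n → abel (prefixWord u1 n) ≠ abel (prefixWord u2 n) := by
    intro n hn h
    have hfst : ((prefixWord u1 n).count AB.a : ℤ) = (prefixWord u2 n).count AB.a :=
      congrArg Prod.fst h
    have := count_eq n hn
    omega
  refine ⟨count_eq, abel_ne, fun m n h => ?_⟩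
  have hm := abel_fst_add_snd (prefixWord u1 m)
  have hn := abel_fst_add_snd (prefixWord u2 n)
  rw [h, hn] at hm
  obtain rfl : n = m := by simpa [prefixWord] using hm
  have : ¬1 ≤ n := fun hn => abel_ne n hn h
  omega

end Stmt12
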